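/- arXiv:2410.01321 — 3 statements merged into one kernel-verified Lean document; each statement's English description precedes it below -/
import Mathlib

section
/- (Local Glaeser inequality.) Let I ⊆ ℝ be an open bounded interval and let f ∈ C^{1,1}(cl I) satisfy f ≥ 0 on I or f ≤ 0 on I. Let M > 0, x_0 ∈ I with f(x_0) ≠ 0, and assume I_0 := (x_0 − M^{−1}|f(x_0)|^{1/2}, x_0 + M^{−1}|f(x_0)|^{1/2}) ⊆ I. Then |f'(x_0)| ≤ (M + M^{−1} |f'|_{C^{0,1}(cl I_0)}) · |f(x_0)|^{1/2}. If additionally |f'|_{C^{0,1}(cl I_0)} ≤ M², then |f'(x_0)| ≤ 2M |f(x_0)|^{1/2}. Moreover, if f(x_0) = 0 then f'(x_0) = 0. -/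
open Set Filter Topology Metric

/-- If `f ≥ 0` on the ball of radius `r` around `a` and `f'` is `L`-Lipschitz at `a` there, then
`r |f'(a)| ≤ f(a) + L r²`. -/
theorem mul_abs_deriv_le_of_nonneg {f f' : ℝ → ℝ} {a r L : ℝ} (hr : 0 < r) (hL : 0 ≤ L)
    (hderiv : ∀ x ∈ Ioo (a - r) (a + r), HasDerivAt f (f' x) x)
    (hf : ∀ x ∈ Ioo (a - r) (a + r), 0 ≤ f x)
    (hlip : ∀ x ∈ Ioo (a - r) (a + r), |f' x - f' a| ≤ L * |x - a|) :
    r * |f' a| ≤ f a + L * r ^ 2 := by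
  have key : ∀ δ ∈ Ioo 0 r, δ * |f' a| ≤ f a + L * δ ^ 2 := by
    rintro δ ⟨hδ0, hδr⟩
    have hsub : ∀ x ∈ Icc (a - δ) (a + δ), x ∈ Ioo (a - r) (a + r) := fun x hx =>
      ⟨by linarith [hx.1], by linarith [hx.2]⟩
    have hg : ∀ y ∈ Icc (a - δ) (a + δ),
        ‖(f y - f' a * y) - (f a - f' a * a)‖ ≤ L * δ * ‖y - a‖ := by
      intro y hy
      refine (convex_Icc (a - δ) (a + δ)).norm_image_sub_le_of_norm_hasDerivWithin_le
        (f := fun x => f x - f' a * x) (f' := fun x => f' x - f' a * 1)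
        (fun x hx => ((hderiv x (hsub x hx)).sub
          ((hasDerivAt_id x).const_mul (f' a))).hasDerivWithinAt)
        (fun x hx => ?_) ⟨by linarith, by linarith⟩ hy
      rw [mul_one, Real.norm_eq_abs]
      refine (hlip x (hsub x hx)).trans (mul_le_mul_of_nonneg_left ?_ hL)
      rw [abs_le]
      constructor <;> linarith [hx.1, hx.2]
    have hright : a + δ ∈ Icc (a - δ) (a + δ) := ⟨by linarith, le_rfl⟩
    have hleft : a - δ ∈ Icc (a - δ) (a + δ) := ⟨le_rfl, by linarith⟩
    have h1 := hg _ hright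
    have h2 := hg _ hleft
    have h3 := hf _ (hsub _ hright)
    have h4 := hf _ (hsub _ hleft)
    rw [Real.norm_eq_abs, Real.norm_eq_abs, add_sub_cancel_left, abs_of_pos hδ0] at h1
    rw [Real.norm_eq_abs, Real.norm_eq_abs, sub_sub_cancel_left, abs_neg, abs_of_pos hδ0] at h2
    have h1' := (abs_le.1 h1).2
    have h2' := (abs_le.1 h2).2
    rcases abs_cases (f' a) with ⟨h, _⟩ | ⟨h, _⟩ <;> rw [h] <;> nlinarith
  have hlim : ∀ g : ℝ → ℝ, Continuous g → Tendsto g (𝓝[<] r) (𝓝 (g r)) := fun g hg =>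
    hg.continuousAt.tendsto.mono_left nhdsWithin_le_nhds
  exact le_of_tendsto_of_tendsto (hlim (fun δ => δ * |f' a|) (by fun_prop))
    (hlim (fun δ => f a + L * δ ^ 2) (by fun_prop))
    (Filter.eventually_of_mem (Ioo_mem_nhdsLT hr) key)

/-- The local Glaeser inequality in terms of the absolute value of a function of constant sign. -/
theorem mul_abs_deriv_le_of_sign {f f' : ℝ → ℝ} {a r L : ℝ} (hr : 0 < r) (hL : 0 ≤ L)
    (hderiv : ∀ x ∈ Ioo (a - r) (a + r), HasDerivAt f (f' x) x)
    (hf : (∀ x ∈ Ioo (a - r) (a + r), 0 ≤ f x) ∨ ∀ x ∈ Ioo (a - r) (a + r), f x ≤ 0)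
    (hlip : ∀ x ∈ Ioo (a - r) (a + r), |f' x - f' a| ≤ L * |x - a|) :
    r * |f' a| ≤ |f a| + L * r ^ 2 := by
  rcases hf with hf | hf
  · have := mul_abs_deriv_le_of_nonneg hr hL hderiv hf hlip
    linarith [le_abs_self (f a)]
  · have := mul_abs_deriv_le_of_nonneg (f := fun x => -f x) (f' := fun x => -f' x) hr hL
      (fun x hx => (hderiv x hx).fun_neg) (fun x hx => neg_nonneg.2 (hf x hx))
      (fun x hx => by rw [← neg_sub', abs_neg]; exact hlip x hx)
    rw [abs_neg] at this
    linarith [neg_le_abs (f a)]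

/-- local Glaeser inequality.  Let `f ∈ C^{1,1}(cl I)` on a bounded open
interval `I = (s,t)` with `f ≥ 0` or `f ≤ 0` on `I`.  Let `M > 0`, `x₀ ∈ I` with
`f(x₀) ≠ 0` and `I₀ := (x₀ - M⁻¹|f(x₀)|^{1/2}, x₀ + M⁻¹|f(x₀)|^{1/2}) ⊆ I`.  Then
`|f'(x₀)| ≤ (M + M⁻¹ L) |f(x₀)|^{1/2}` for any Lipschitz bound `L` of `f'` on `I₀`;
if moreover `L ≤ M²`, then `|f'(x₀)| ≤ 2M |f(x₀)|^{1/2}`.  Moreover, if `f(x₀) = 0`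
then `f'(x₀) = 0`. -/
theorem stmt9 (s t : ℝ) (hst : s < t) (f f' : ℝ → ℝ)
    (hderiv : ∀ x ∈ Ioo s t, HasDerivAt f (f' x) x)
    (hC11 : ∃ L' : NNReal, LipschitzOnWith L' f' (Ioo s t))
    (hsign : (∀ x ∈ Ioo s t, 0 ≤ f x) ∨ (∀ x ∈ Ioo s t, f x ≤ 0))
    (x₀ : ℝ) (hx₀ : x₀ ∈ Ioo s t) (M : ℝ) (hM : 0 < M) :
    (f x₀ ≠ 0 →
      Ioo (x₀ - M⁻¹ * Real.sqrt |f x₀|) (x₀ + M⁻¹ * Real.sqrt |f x₀|) ⊆ Ioo s t →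
      ∀ L : ℝ, 0 ≤ L →
      (∀ x ∈ Ioo (x₀ - M⁻¹ * Real.sqrt |f x₀|) (x₀ + M⁻¹ * Real.sqrt |f x₀|),
       ∀ y ∈ Ioo (x₀ - M⁻¹ * Real.sqrt |f x₀|) (x₀ + M⁻¹ * Real.sqrt |f x₀|),
        |f' x - f' y| ≤ L * |x - y|) →
      |f' x₀| ≤ (M + M⁻¹ * L) * Real.sqrt |f x₀| ∧
        (L ≤ M ^ 2 → |f' x₀| ≤ 2 * M * Real.sqrt |f x₀|)) ∧
    (f x₀ = 0 → f' x₀ = 0) := by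
  constructor
  · intro hne hsub L hL hlip
    set q := Real.sqrt |f x₀| with hq
    have hq0 : 0 < q := Real.sqrt_pos.2 (abs_pos.2 hne)
    have hqq : |f x₀| = q ^ 2 := (Real.sq_sqrt (abs_nonneg _)).symm
    have hr : 0 < M⁻¹ * q := by positivity
    have h := mul_abs_deriv_le_of_sign hr hL (fun x hx => hderiv x (hsub hx))
      (hsign.imp (fun h x hx => h x (hsub hx)) (fun h x hx => h x (hsub hx)))
      (fun x hx => hlip x hx x₀ ⟨by linarith, by linarith⟩)
    have hmain : |f' x₀| ≤ (M + M⁻¹ * L) * q := by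
      refine le_of_mul_le_mul_left (h.trans_eq ?_) hr
      rw [hqq]
      field_simp
    refine ⟨hmain, fun hLM => hmain.trans (mul_le_mul_of_nonneg_right ?_ hq0.le)⟩
    have : M⁻¹ * L ≤ M⁻¹ * M ^ 2 := by gcongr
    have hM2 : M⁻¹ * M ^ 2 = M := by field_simp
    linarith
  · intro h0
    have hnhds : Ioo s t ∈ 𝓝 x₀ := Ioo_mem_nhds hx₀.1 hx₀.2
    rcases hsign with h | h
    · have hmin : IsLocalMin f x₀ := by
        filter_upwards [hnhds] with x hx
        rw [h0]
        exact h x hx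
      exact hmin.hasDerivAt_eq_zero (hderiv x₀ hx₀)
    · have hmax : IsLocalMax f x₀ := by
        filter_upwards [hnhds] with x hx
        rw [h0]
        exact h x hx
      exact hmax.hasDerivAt_eq_zero (hderiv x₀ hx₀)
end

section
/- (Interpolation of intermediate derivatives.) There is a constant C(k) depending only on k with the following property. Let I ⊆ ℝ be a bounded open interval and let f ∈ C^{k,1}(cl I), i.e., f is of class C^k on I with all derivatives up to order k extending continuously to cl I and with Lipschitz k-th derivative. Then, for every 1 ≤ j ≤ k and every x ∈ I, |f^{(j)}(x)| ≤ C(k) · |I|^{−j} · ( ‖f‖_{L^∞(I)} + |f^{(k)}|_{C^{0,1}(cl I)} · |I|^{k+1} ), where |I| denotes the length of I. -/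
open Set Filter Topology Metric

/-- If `F 0, F 1, …, F k` are successive derivatives on `[s, t]` and `|F 0| ≤ B`, then `F k` is
controlled by `B` at some point of `[s, t]`. -/
theorem exists_abs_deriv_le (k : ℕ) : ∃ D : ℝ, 0 < D ∧
    ∀ s t : ℝ, s < t → ∀ F : ℕ → ℝ → ℝ,
    (∀ i < k, ∀ x ∈ Icc s t, HasDerivWithinAt (F i) (F (i + 1) x) (Icc s t) x) →
    ∀ B : ℝ, (∀ x ∈ Icc s t, |F 0 x| ≤ B) →
    ∃ ξ ∈ Icc s t, |F k ξ| ≤ D * B / (t - s) ^ k := by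
  induction k with
  | zero =>
    refine ⟨1, one_pos, fun s t hst F _ B hB => ⟨s, left_mem_Icc.2 hst.le, ?_⟩⟩
    simpa using hB s (left_mem_Icc.2 hst.le)
  | succ k ih =>
    obtain ⟨D, hD, ih⟩ := ih
    refine ⟨2 * D * 3 ^ (k + 1), by positivity, fun s t hst F hF B hB => ?_⟩
    have hpos : 0 < t - s := sub_pos.2 hst
    have restrict : ∀ a b, s ≤ a → a < b → b ≤ t →
        ∃ ξ ∈ Icc a b, |F k ξ| ≤ D * B / (b - a) ^ k := fun a b ha hab hb =>
      have hsub : Icc a b ⊆ Icc s t := Icc_subset_Icc ha hb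
      ih a b hab F (fun i hi x hx => (hF i (hi.trans k.lt_succ_self) x (hsub hx)).mono hsub) B
        (fun x hx => hB x (hsub hx))
    obtain ⟨u, hu, hFu⟩ := restrict s (s + (t - s) / 3) le_rfl (by linarith) (by linarith)
    obtain ⟨v, hv, hFv⟩ := restrict (t - (t - s) / 3) t (by linarith) (by linarith) le_rfl
    rw [show s + (t - s) / 3 - s = (t - s) / 3 by ring] at hFu
    rw [show t - (t - (t - s) / 3) = (t - s) / 3 by ring] at hFv
    have huv : (t - s) / 3 ≤ v - u := by linarith [hu.2, hv.1]
    have huv' : u < v := by linarith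
    have hsub : Icc u v ⊆ Icc s t := Icc_subset_Icc hu.1 hv.2
    obtain ⟨ξ, hξ, hξ'⟩ := exists_hasDerivAt_eq_slope (F k) (F (k + 1)) huv'
      (fun x hx => ((hF k k.lt_succ_self x (hsub hx)).mono hsub).continuousWithinAt)
      (fun x hx => (hF k k.lt_succ_self x (hsub (Ioo_subset_Icc_self hx))).hasDerivAt
        (Icc_mem_nhds (hu.1.trans_lt hx.1) (hx.2.trans_le hv.2)))
    refine ⟨ξ, hsub (Ioo_subset_Icc_self hξ), ?_⟩
    rw [hξ', abs_div, abs_of_pos (sub_pos.2 huv')]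
    calc |F k v - F k u| / (v - u)
        ≤ (2 * (D * B / ((t - s) / 3) ^ k)) / ((t - s) / 3) := by
          have := abs_sub (F k v) (F k u)
          have h2 : |F k v - F k u| ≤ 2 * (D * B / ((t - s) / 3) ^ k) := by linarith
          exact div_le_div₀ ((abs_nonneg _).trans h2) h2 (by positivity) huv
      _ = 2 * D * 3 ^ (k + 1) * B / (t - s) ^ (k + 1) := by
          rw [div_pow]
          field_simp
          ring

/-- Interpolation of intermediate derivatives for a sequence `F 0, F 1, …, F k` of successive
derivatives on `[s, t]`. -/
theorem abs_deriv_le_of_lipschitz (k : ℕ) : ∃ C : ℝ, 0 < C ∧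
    ∀ s t : ℝ, s < t → ∀ F : ℕ → ℝ → ℝ,
    (∀ i < k, ∀ x ∈ Icc s t, HasDerivWithinAt (F i) (F (i + 1) x) (Icc s t) x) →
    ∀ L : ℝ, 0 ≤ L → (∀ x ∈ Icc s t, ∀ y ∈ Icc s t, |F k x - F k y| ≤ L * |x - y|) →
    ∀ B : ℝ, (∀ x ∈ Icc s t, |F 0 x| ≤ B) →
    ∀ j ≤ k, ∀ x ∈ Icc s t,
      |F j x| ≤ C * ((t - s) ^ j)⁻¹ * (B + L * (t - s) ^ (k + 1)) := by
  induction k with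
  | zero =>
    refine ⟨1, one_pos, fun s t hst F _ L hL _ B hB j hj x hx => ?_⟩
    obtain rfl : j = 0 := Nat.le_zero.1 hj
    have : 0 ≤ L * (t - s) := mul_nonneg hL (sub_pos.2 hst).le
    simpa using (hB x hx).trans (le_add_of_nonneg_right this)
  | succ k ih =>
    obtain ⟨C, hC, ih⟩ := ih
    obtain ⟨D, hD, hpt⟩ := exists_abs_deriv_le (k + 1)
    refine ⟨(C + 1) * (D + 1), by positivity, fun s t hst F hF L hL hLip B hB j hj x hx => ?_⟩
    have hpos : 0 < t - s := sub_pos.2 hst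
    have hB0 : 0 ≤ B := (abs_nonneg _).trans (hB x hx)
    obtain ⟨ξ, hξ, hFξ⟩ := hpt s t hst F hF B hB
    set M := D * B / (t - s) ^ (k + 1) + L * (t - s) with hM
    have hM0 : 0 ≤ M := by positivity
    have htop : ∀ y ∈ Icc s t, |F (k + 1) y| ≤ M := fun y hy => by
      have h1 : |y - ξ| ≤ t - s :=
        abs_sub_le_iff.2 ⟨by linarith [hy.2, hξ.1], by linarith [hξ.2, hy.1]⟩
      have h2 := (hLip y hy ξ hξ).trans (mul_le_mul_of_nonneg_left h1 hL)
      have h3 := abs_sub_abs_le_abs_sub (F (k + 1) y) (F (k + 1) ξ)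
      linarith
    have hMmul : M * (t - s) ^ (k + 1) = D * B + L * (t - s) ^ (k + 2) := by
      rw [hM]; field_simp; ring
    have hLpow : 0 ≤ L * (t - s) ^ (k + 2) := by positivity
    have hbound : B + M * (t - s) ^ (k + 1) ≤ (D + 1) * (B + L * (t - s) ^ (k + 2)) := by
      rw [hMmul]; nlinarith
    rcases hj.lt_or_eq with hj | rfl
    · calc |F j x| ≤ C * ((t - s) ^ j)⁻¹ * (B + M * (t - s) ^ (k + 1)) := by
            refine ih s t hst F (fun i hi => hF i (hi.trans k.lt_succ_self)) M hM0
              (fun y hy z hz => ?_) B hB j (Nat.lt_succ_iff.1 hj) x hx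
            exact (convex_Icc s t).norm_image_sub_le_of_norm_hasDerivWithin_le
              (hF k k.lt_succ_self) htop hz hy
        _ ≤ (C + 1) * ((t - s) ^ j)⁻¹ * ((D + 1) * (B + L * (t - s) ^ (k + 2))) := by
            gcongr
            linarith
        _ = _ := by ring
    · calc |F (k + 1) x| ≤ M := htop x hx
        _ = 1 * ((t - s) ^ (k + 1))⁻¹ * (M * (t - s) ^ (k + 1)) := by field_simp
        _ ≤ (C + 1) * ((t - s) ^ (k + 1))⁻¹ * ((D + 1) * (B + L * (t - s) ^ (k + 2))) := by
            refine mul_le_mul ?_ (by linarith) (by positivity) (by positivity)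
            gcongr
            linarith
        _ = _ := by ring

/-- interpolation of intermediate derivatives.  There is a constant `C(k)`
such that for every bounded open interval `I = (s,t)`, every `f ∈ C^{k,1}(cl I)` (encoded by
`ContDiffOn` on `Icc s t` together with a Lipschitz bound `L` for the `k`-th derivative),
every bound `B` for `sup_I |f|`, every `1 ≤ j ≤ k` and every `x ∈ I`:
`|f⁽ʲ⁾(x)| ≤ C ⋅ |I|⁻ʲ ⋅ (B + L ⋅ |I|^{k+1})`. -/
theorem stmt10 (k : ℕ) : ∃ C : ℝ, 0 < C ∧
    ∀ s t : ℝ, s < t → ∀ f : ℝ → ℝ, ContDiffOn ℝ k f (Icc s t) →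
    ∀ L : ℝ, 0 ≤ L →
    (∀ x ∈ Icc s t, ∀ y ∈ Icc s t,
      |iteratedDerivWithin k f (Icc s t) x - iteratedDerivWithin k f (Icc s t) y| ≤
        L * |x - y|) →
    ∀ B : ℝ, (∀ x ∈ Ioo s t, |f x| ≤ B) →
    ∀ j : ℕ, 1 ≤ j → j ≤ k → ∀ x ∈ Ioo s t,
      |iteratedDerivWithin j f (Icc s t) x| ≤
        C * ((t - s) ^ j)⁻¹ * (B + L * (t - s) ^ (k + 1)) := by
  obtain ⟨C, hC, h⟩ := abs_deriv_le_of_lipschitz k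
  refine ⟨C, hC, fun s t hst f hf L hL hLip B hB j _ hj x hx => ?_⟩
  refine h s t hst (fun i => iteratedDerivWithin i f (Icc s t)) (fun i hi y hy => ?_) L hL hLip B
    (fun y hy => ?_) j hj x (Ioo_subset_Icc_self hx)
  · rw [iteratedDerivWithin_succ]
    exact ((hf.differentiableOn_iteratedDerivWithin (by exact_mod_cast hi)
      (uniqueDiffOn_Icc hst)) y hy).hasDerivWithinAt
  · rw [← closure_Ioo hst.ne] at hy
    have hcont : ContinuousOn (fun z => |f z|) (closure (Ioo s t)) := by
      rw [closure_Ioo hst.ne]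
      exact hf.continuousOn.abs
    simpa using le_on_closure hB hcont continuousOn_const hy
end

section
/- (Composition estimate.) Let U ⊆ ℝ^m and V ⊆ ℝ^ℓ be open, bounded, and convex, let k ∈ ℕ, and let ψ ∈ C^{k+1}(cl V, ℝ^p). Then the map φ ↦ ψ∘φ from C^k(cl U, V) to C^k(cl U, ℝ^p) is well-defined and continuous; more precisely, for every bounded subset B of C^k(cl U, V) there is a constant C = C(k, B) such that for all φ_1, φ_2 ∈ B: ‖ψ∘φ_1 − ψ∘φ_2‖_{C^k(cl U, ℝ^p)} ≤ C · ‖ψ‖_{C^{k+1}(cl V, ℝ^p)} · ‖φ_1 − φ_2‖_{C^k(cl U, ℝ^ℓ)}. -/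
open Set Filter Topology Metric

/-- A quantitative bound for the difference of two Taylor compositions. -/
theorem FormalMultilinearSeries.norm_taylorComp_sub_taylorComp_le
    {𝕜 E F G : Type*} [NontriviallyNormedField 𝕜]
    [NormedAddCommGroup E] [NormedSpace 𝕜 E] [NormedAddCommGroup F] [NormedSpace 𝕜 F]
    [NormedAddCommGroup G] [NormedSpace 𝕜 G]
    {q₁ q₂ : FormalMultilinearSeries 𝕜 F G} {p₁ p₂ : FormalMultilinearSeries 𝕜 E F}
    {n : ℕ} {N R D : ℝ} (hN : 0 ≤ N) (hR : 0 ≤ R) (hD : 0 ≤ D)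
    (hq : ∀ i ≤ n, ‖q₁ i‖ ≤ N) (hqD : ∀ i ≤ n, ‖q₁ i - q₂ i‖ ≤ N * D)
    (hp₁ : ∀ i ≤ n, ‖p₁ i‖ ≤ R) (hp₂ : ∀ i ≤ n, ‖p₂ i‖ ≤ R)
    (hpD : ∀ i ≤ n, ‖p₁ i - p₂ i‖ ≤ D) :
    ‖q₁.taylorComp p₁ n - q₂.taylorComp p₂ n‖ ≤
      (∑ c : OrderedFinpartition n, (c.length * R ^ (c.length - 1) + R ^ c.length)) * N * D := by
  simp only [FormalMultilinearSeries.taylorComp, ← Finset.sum_sub_distrib, Finset.sum_mul]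
  refine norm_sum_le_of_le _ fun c _ ↦ ?_
  refine (c.norm_compAlongOrderedFinpartition_sub_compAlongOrderedFinpartition_le ..).trans ?_
  have h₁ : ‖fun i ↦ p₁ (c.partSize i)‖ ≤ R :=
    (pi_norm_le_iff_of_nonneg hR).2 fun i ↦ hp₁ _ (c.partSize_le i)
  have h₂ : ‖fun i ↦ p₂ (c.partSize i)‖ ≤ R :=
    (pi_norm_le_iff_of_nonneg hR).2 fun i ↦ hp₂ _ (c.partSize_le i)
  have h₃ : ‖(fun i ↦ p₁ (c.partSize i)) - fun i ↦ p₂ (c.partSize i)‖ ≤ D :=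
    (pi_norm_le_iff_of_nonneg hD).2 fun i ↦ hpD _ (c.partSize_le i)
  have h₄ : ∏ i, ‖p₂ (c.partSize i)‖ ≤ R ^ c.length := by
    simpa using Finset.prod_le_prod (s := Finset.univ) (fun i _ ↦ norm_nonneg (p₂ (c.partSize i)))
      fun i _ ↦ hp₂ _ (c.partSize_le i)
  calc
    _ ≤ N * c.length * R ^ (c.length - 1) * D + N * D * R ^ c.length := by
      gcongr
      · exact hq _ c.length_le
      · exact max_le h₁ h₂
      · exact hqD _ c.length_le
    _ = _ := by ring

/-- On a convex set, a bound on the `(i + 1)`-th derivative gives a Lipschitz bound on the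
`i`-th derivative. -/
theorem ContDiffOn.norm_iteratedFDerivWithin_sub_le
    {F G : Type*} [NormedAddCommGroup F] [NormedSpace ℝ F] [NormedAddCommGroup G] [NormedSpace ℝ G]
    {ψ : F → G} {s : Set F} {n : WithTop ℕ∞} (hψ : ContDiffOn ℝ n ψ s) (hs : UniqueDiffOn ℝ s)
    (hc : Convex ℝ s) {i : ℕ} (hi : i < n) {N : ℝ}
    (hN : ∀ y ∈ s, ‖iteratedFDerivWithin ℝ (i + 1) ψ s y‖ ≤ N) {x y : F} (hx : x ∈ s)
    (hy : y ∈ s) :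
    ‖iteratedFDerivWithin ℝ i ψ s x - iteratedFDerivWithin ℝ i ψ s y‖ ≤ N * ‖x - y‖ :=
  hc.norm_image_sub_le_of_norm_fderivWithin_le (𝕜 := ℝ)
    (hψ.differentiableOn_iteratedFDerivWithin hi hs)
    (fun z hz ↦ norm_fderivWithin_iteratedFDerivWithin.trans_le (hN z hz)) hy hx

/-- composition estimate.  Let `U ⊆ ℝ^m`, `V ⊆ ℝ^ℓ` be open, bounded and
convex, `k ∈ ℕ`, and `ψ ∈ C^{k+1}(cl V, ℝ^p)`.  Then `φ ↦ ψ ∘ φ` is well-defined from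
`C^k(cl U, V)` to `C^k(cl U, ℝ^p)`, and on every bounded subset (encoded by a bound `R` on the
`C^k` norms) it satisfies
`‖ψ∘φ₁ - ψ∘φ₂‖_{C^k} ≤ C(k, B) ⋅ ‖ψ‖_{C^{k+1}} ⋅ ‖φ₁ - φ₂‖_{C^k}` (the norms on the
right encoded by arbitrary upper bounds `Nψ` and `D`). -/
theorem stmt19 (m ℓ p k : ℕ)
    (U : Set (EuclideanSpace ℝ (Fin m))) (hUo : IsOpen U) (hUb : Bornology.IsBounded U)
    (hUc : Convex ℝ U)
    (V : Set (EuclideanSpace ℝ (Fin ℓ))) (hVo : IsOpen V) (hVb : Bornology.IsBounded V)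
    (hVc : Convex ℝ V)
    (R : ℝ) (hR : 0 < R) :
    ∃ C : ℝ, 0 < C ∧
    ∀ ψ : EuclideanSpace ℝ (Fin ℓ) → EuclideanSpace ℝ (Fin p),
      ContDiffOn ℝ (k + 1) ψ (closure V) →
    ∀ Nψ : ℝ,
      (∀ j ≤ k + 1, ∀ y ∈ closure V, ‖iteratedFDerivWithin ℝ j ψ (closure V) y‖ ≤ Nψ) →
    ∀ φ₁ φ₂ : EuclideanSpace ℝ (Fin m) → EuclideanSpace ℝ (Fin ℓ),
      ContDiffOn ℝ k φ₁ (closure U) → ContDiffOn ℝ k φ₂ (closure U) →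
      (∀ x ∈ closure U, φ₁ x ∈ V) → (∀ x ∈ closure U, φ₂ x ∈ V) →
      (∀ j ≤ k, ∀ x ∈ closure U, ‖iteratedFDerivWithin ℝ j φ₁ (closure U) x‖ ≤ R) →
      (∀ j ≤ k, ∀ x ∈ closure U, ‖iteratedFDerivWithin ℝ j φ₂ (closure U) x‖ ≤ R) →
      -- well-definedness
      ContDiffOn ℝ k (ψ ∘ φ₁) (closure U) ∧
      -- the Lipschitz estimate
      ∀ D : ℝ,
        (∀ j ≤ k, ∀ x ∈ closure U,
          ‖iteratedFDerivWithin ℝ j φ₁ (closure U) x -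
            iteratedFDerivWithin ℝ j φ₂ (closure U) x‖ ≤ D) →
        ∀ j ≤ k, ∀ x ∈ closure U,
          ‖iteratedFDerivWithin ℝ j (ψ ∘ φ₁) (closure U) x -
            iteratedFDerivWithin ℝ j (ψ ∘ φ₂) (closure U) x‖ ≤ C * Nψ * D := by
  set S : ℕ → ℝ := fun j ↦
    ∑ c : OrderedFinpartition j, (c.length * R ^ (c.length - 1) + R ^ c.length)
  have hS0 : ∀ j, 0 ≤ S j := fun j ↦ Finset.sum_nonneg fun c _ ↦ by positivity
  refine ⟨1 + ∑ j ∈ Finset.range (k + 1), S j,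
    add_pos_of_pos_of_nonneg one_pos (Finset.sum_nonneg fun j _ ↦ hS0 j), ?_⟩
  intro ψ hψ Nψ hN φ₁ φ₂ hφ₁ hφ₂ hm₁ hm₂ hR₁ hR₂
  have hmaps₁ : MapsTo φ₁ (closure U) (closure V) := fun x hx ↦ subset_closure (hm₁ x hx)
  have hmaps₂ : MapsTo φ₂ (closure U) (closure V) := fun x hx ↦ subset_closure (hm₂ x hx)
  have hψk : ContDiffOn ℝ k ψ (closure V) := hψ.of_le le_self_add
  refine ⟨hψk.comp hφ₁ hmaps₁, fun D hD j hj x hx ↦ ?_⟩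
  have hUu : UniqueDiffOn ℝ (closure U) := uniqueDiffOn_convex hUc.closure <|
    (closure_nonempty_iff.1 ⟨x, hx⟩).mono (interior_maximal subset_closure hUo)
  have hVu : UniqueDiffOn ℝ (closure V) := uniqueDiffOn_convex hVc.closure <|
    Nonempty.mono (interior_maximal subset_closure hVo) ⟨φ₁ x, hm₁ x hx⟩
  have hN0 : 0 ≤ Nψ := (norm_nonneg _).trans (hN 0 (Nat.zero_le _) _ (hmaps₁ hx))
  have hD0 : 0 ≤ D := (norm_nonneg _).trans (hD 0 (Nat.zero_le _) x hx)
  have hφD : ‖φ₁ x - φ₂ x‖ ≤ D := by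
    simpa only [iteratedFDerivWithin_zero_eq_comp, Function.comp_apply, ← map_sub,
      LinearIsometryEquiv.norm_map] using hD 0 (Nat.zero_le _) x hx
  rw [iteratedFDerivWithin_comp (hψk _ (hmaps₁ hx)) (hφ₁ x hx) hVu hUu hx hmaps₁
      (Nat.cast_le.2 hj),
    iteratedFDerivWithin_comp (hψk _ (hmaps₂ hx)) (hφ₂ x hx) hVu hUu hx hmaps₂
      (Nat.cast_le.2 hj)]
  refine (FormalMultilinearSeries.norm_taylorComp_sub_taylorComp_le hN0 hR.le hD0
    (fun i hi ↦ hN i (by lia) _ (hmaps₁ hx)) (fun i hi ↦ ?_)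
    (fun i hi ↦ hR₁ i (hi.trans hj) x hx) (fun i hi ↦ hR₂ i (hi.trans hj) x hx)
    (fun i hi ↦ hD i (hi.trans hj) x hx)).trans ?_
  · refine (hψ.norm_iteratedFDerivWithin_sub_le hVu hVc.closure ?_
      (fun y hy ↦ hN (i + 1) (by lia) y hy) (hmaps₁ hx) (hmaps₂ hx)).trans
      (mul_le_mul_of_nonneg_left hφD hN0)
    exact_mod_cast Nat.lt_succ_of_le (hi.trans hj)
  · gcongr
    have h : S j ≤ ∑ j ∈ Finset.range (k + 1), S j :=
      Finset.single_le_sum (fun i _ ↦ hS0 i) (Finset.mem_range.2 (Nat.lt_succ_of_le hj))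
    exact h.trans (le_add_of_nonneg_left zero_le_one)
end
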